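/- For z, z' ∈ Her_m(ℂ), z and z' lie in the same B_m(ℂ)-orbit (under b·z = b z b*) if and only if for all 0 ≤ p ≤ q < m the ranks of the submatrices z_{[p]ᶜ[q]ᶜ} and z'_{[p]ᶜ[q]ᶜ} agree and for all 0 ≤ p < m the signatures of the principal submatrices z_{[p]ᶜ} and z'_{[p]ᶜ} agree. -/

import Mathlib

open Matrix

/-- The inclusion of `{p+1, ..., m}` (as `Fin (m - p)`) into `Fin m`. -/
def tailEmb (m p : ℕ) (hp : p ≤ m) : Fin (m - p) → Fin m :=
  fun i => ⟨p + i.1, by have := i.isLt; omega⟩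

/-- The signature of a Hermitian matrix: the number of positive eigenvalues, the
number of negative eigenvalues, and the dimension of the kernel. -/
noncomputable def signature {k : ℕ} {A : Matrix (Fin k) (Fin k) ℂ}
    (hA : A.IsHermitian) : ℕ × ℕ × ℕ :=
  (Nat.card {i // 0 < hA.eigenvalues i},
   Nat.card {i // hA.eigenvalues i < 0},
   Nat.card {i // hA.eigenvalues i = 0})


def BRel {m : ℕ} (z z' : Matrix (Fin m) (Fin m) ℂ) : Prop :=
  ∃ b : Matrix (Fin m) (Fin m) ℂ, IsUnit b ∧ b.BlockTriangular id ∧ b * z * bᴴ = z'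

lemma BRel.trans {m : ℕ} {x y z : Matrix (Fin m) (Fin m) ℂ} (h : BRel x y) (h' : BRel y z) :
    BRel x z := by
  obtain ⟨b, hb, tb, rfl⟩ := h
  obtain ⟨c, hc, tc, rfl⟩ := h'
  exact ⟨c * b, hc.mul hb, tc.mul tb, by simp only [conjTranspose_mul, Matrix.mul_assoc]⟩

lemma BRel.refl {m : ℕ} (x : Matrix (Fin m) (Fin m) ℂ) : BRel x x :=
  ⟨1, isUnit_one, blockTriangular_one, by simp⟩

lemma BRel.symm {m : ℕ} {x y : Matrix (Fin m) (Fin m) ℂ} (h : BRel x y) : BRel y x := by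
  obtain ⟨b, hb, tb, rfl⟩ := h
  have hd : IsUnit b.det := (Matrix.isUnit_iff_isUnit_det b).1 hb
  have : Invertible b := hb.invertible
  refine ⟨b⁻¹, ?_, blockTriangular_inv_of_blockTriangular tb, ?_⟩
  · exact (Matrix.isUnit_nonsing_inv_iff).2 hb
  · have h2 : bᴴ * (b⁻¹)ᴴ = 1 := by
      rw [← conjTranspose_mul, Matrix.nonsing_inv_mul _ hd, conjTranspose_one]
    calc b⁻¹ * (b * x * bᴴ) * (b⁻¹)ᴴ = (b⁻¹ * b) * x * (bᴴ * (b⁻¹)ᴴ) := by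
          simp only [Matrix.mul_assoc]
      _ = x := by rw [h2, Matrix.nonsing_inv_mul _ hd]; simp

lemma BRel.herm {m : ℕ} {x y : Matrix (Fin m) (Fin m) ℂ} (h : BRel x y) (hx : x.IsHermitian) :
    y.IsHermitian := by
  obtain ⟨b, hb, tb, rfl⟩ := h
  exact isHermitian_mul_mul_conjTranspose b hx

lemma tailEmb_sum {M : Type*} [AddCommMonoid M] (m p : ℕ) (hp : p ≤ m) (f : Fin m → M) :
    ∑ i, f (tailEmb m p hp i) = ∑ i, if p ≤ i.1 then f i else 0 := by
  rw [← Finset.sum_filter]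
  refine Finset.sum_bij (fun i _ => tailEmb m p hp i) ?_ ?_ ?_ ?_
  · intro i _; simp [tailEmb]
  · intro i _ j _ h; simp [tailEmb, Fin.ext_iff] at h; exact Fin.ext h
  · intro j hj
    simp at hj
    refine ⟨⟨j.1 - p, by omega⟩, Finset.mem_univ _, ?_⟩
    simp [tailEmb, Fin.ext_iff]; omega
  · intros; rfl

lemma tail_mul {m : ℕ} (b z : Matrix (Fin m) (Fin m) ℂ) (tb : b.BlockTriangular id) (p q : ℕ)
    (hp : p ≤ m) (hq : q ≤ m) :
    (b * z * bᴴ).submatrix (tailEmb m p hp) (tailEmb m q hq) =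
      b.submatrix (tailEmb m p hp) (tailEmb m p hp) *
      z.submatrix (tailEmb m p hp) (tailEmb m q hq) *
      (b.submatrix (tailEmb m q hq) (tailEmb m q hq))ᴴ := by
  ext i j
  simp only [Matrix.submatrix_apply, Matrix.mul_apply, Matrix.conjTranspose_apply]
  rw [tailEmb_sum m q hq (fun k => (∑ l, b (tailEmb m p hp i) (tailEmb m p hp l) *
    z (tailEmb m p hp l) k) * star (b (tailEmb m q hq j) k))]
  refine Finset.sum_congr rfl fun k _ => ?_
  split_ifs with hk
  · congr 1
    rw [tailEmb_sum m p hp (fun l => b (tailEmb m p hp i) l * z l k)]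
    refine Finset.sum_congr rfl fun l _ => ?_
    split_ifs with hl
    · rfl
    · rw [tb (by simp [tailEmb, Fin.lt_def]; omega), zero_mul]
  · rw [tb (i := tailEmb m q hq j) (j := k) (by simp [tailEmb, Fin.lt_def]; omega)]; simp

lemma BRel.rank_le {m : ℕ} {z z' : Matrix (Fin m) (Fin m) ℂ} (h : BRel z z') (p q : ℕ)
    (hp : p ≤ m) (hq : q ≤ m) :
    (z'.submatrix (tailEmb m p hp) (tailEmb m q hq)).rank ≤
    (z.submatrix (tailEmb m p hp) (tailEmb m q hq)).rank := by
  obtain ⟨b, hb, tb, rfl⟩ := h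
  rw [tail_mul b z tb]
  exact (Matrix.rank_mul_le_left _ _).trans (Matrix.rank_mul_le_right _ _)

lemma inertia_diag {k : ℕ} (α β : Fin k → ℝ) (H : Matrix (Fin k) (Fin k) ℂ)
    (h : diagonal (fun i => (α i : ℂ)) = Hᴴ * diagonal (fun i => (β i : ℂ)) * H) :
    Nat.card {i // 0 < α i} ≤ Nat.card {i // 0 < β i} := by
  classical
  have key : ∀ x : Fin k → ℂ, ∑ i, α i * Complex.normSq (x i) =
      ∑ i, β i * Complex.normSq ((H *ᵥ x) i) := by
    intro x
    have h1 : star x ⬝ᵥ (diagonal (fun i => (α i : ℂ)) *ᵥ x) =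
        star (H *ᵥ x) ⬝ᵥ (diagonal (fun i => (β i : ℂ)) *ᵥ (H *ᵥ x)) := by
      rw [h, star_mulVec, ← dotProduct_mulVec, mulVec_mulVec, mulVec_mulVec, Matrix.mul_assoc]
    have h2 : ∀ (γ : Fin k → ℝ) (y : Fin k → ℂ),
        star y ⬝ᵥ (diagonal (fun i => (γ i : ℂ)) *ᵥ y) =
        ((∑ i, γ i * Complex.normSq (y i) : ℝ) : ℂ) := by
      intro γ y
      simp only [dotProduct, mulVec_diagonal, Pi.star_apply]
      push_cast
      refine Finset.sum_congr rfl fun i _ => ?_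
      rw [Complex.normSq_eq_conj_mul_self]
      simp only [RCLike.star_def]
      ring
    rw [h2, h2] at h1
    exact_mod_cast h1
  let ext : ({i // 0 < α i} → ℂ) →ₗ[ℂ] (Fin k → ℂ) :=
    { toFun := fun c i => if hi : 0 < α i then c ⟨i, hi⟩ else 0
      map_add' := by intro c d; ext i; by_cases hi : 0 < α i <;> simp [hi]
      map_smul' := by intro c d; ext i; by_cases hi : 0 < α i <;> simp [hi] }
  let φ : ({i // 0 < α i} → ℂ) →ₗ[ℂ] ({i // 0 < β i} → ℂ) :=
    (LinearMap.funLeft ℂ ℂ (Subtype.val)) ∘ₗ (Matrix.mulVecLin H) ∘ₗ ext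
  have hφ : Function.Injective φ := by
    rw [← LinearMap.ker_eq_bot, LinearMap.ker_eq_bot']
    intro c hc
    have hk := key (ext c)
    have hr : ∑ i, β i * Complex.normSq ((H *ᵥ ext c) i) ≤ 0 := by
      refine Finset.sum_nonpos fun i _ => ?_
      by_cases hi : 0 < β i
      · have : φ c ⟨i, hi⟩ = 0 := by rw [hc]; rfl
        have h3 : (H *ᵥ ext c) i = 0 := this
        simp [h3]
      · exact mul_nonpos_of_nonpos_of_nonneg (not_lt.1 hi) (Complex.normSq_nonneg _)
    have hnn : ∀ i ∈ Finset.univ, 0 ≤ α i * Complex.normSq (ext c i) := by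
      intro i _
      by_cases hi : 0 < α i
      · exact mul_nonneg hi.le (Complex.normSq_nonneg _)
      · simp [ext, hi]
    have h0 := (Finset.sum_eq_zero_iff_of_nonneg hnn).1
      (le_antisymm (hk ▸ hr) (Finset.sum_nonneg hnn))
    funext ⟨i, hi⟩
    have := h0 i (Finset.mem_univ _)
    rcases mul_eq_zero.1 this with h4 | h4
    · exact absurd h4 hi.ne'
    · have := Complex.normSq_eq_zero.1 h4
      simpa [ext, hi] using this
  have := LinearMap.finrank_le_finrank_of_injective hφ
  simpa [Nat.card_eq_fintype_card] using this

lemma inertia_le {k : ℕ} {A B : Matrix (Fin k) (Fin k) ℂ} (hA : A.IsHermitian)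
    (hB : B.IsHermitian) (c : Matrix (Fin k) (Fin k) ℂ) (h : A = c * B * cᴴ) (s : ℝ) :
    Nat.card {i // 0 < s * hA.eigenvalues i} ≤ Nat.card {i // 0 < s * hB.eigenvalues i} := by
  have hs : ∀ {C : Matrix (Fin k) (Fin k) ℂ} (hC : C.IsHermitian),
      ∃ U : Matrix (Fin k) (Fin k) ℂ, Uᴴ * U = 1 ∧
        C = U * diagonal (fun i => (hC.eigenvalues i : ℂ)) * Uᴴ := by
    intro C hC
    refine ⟨hC.eigenvectorUnitary, ?_, ?_⟩
    · exact Unitary.coe_star_mul_self _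
    · conv_lhs => rw [hC.spectral_theorem]
      rw [Unitary.conjStarAlgAut_apply]
      rfl
  obtain ⟨U, hU, eU⟩ := hs hA
  obtain ⟨V, hV, eV⟩ := hs hB
  refine inertia_diag _ _ (Vᴴ * cᴴ * U) ?_
  have h1 : ∀ (γ : Fin k → ℝ), diagonal (fun i => ((s * γ i : ℝ) : ℂ)) =
      (s : ℂ) • diagonal (fun i => (γ i : ℂ)) := by
    intro γ; ext i j; by_cases hij : i = j <;> simp [hij]
  rw [h1, h1]
  rw [Matrix.mul_smul, Matrix.smul_mul]
  congr 1
  have h2 : diagonal (fun i => (hA.eigenvalues i : ℂ)) = Uᴴ * A * U := by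
    conv_rhs => rw [eU]
    simp only [Matrix.mul_assoc]
    rw [hU, Matrix.mul_one, ← Matrix.mul_assoc, hU, Matrix.one_mul]
  rw [h2, h]
  conv_lhs => rw [eV]
  simp only [conjTranspose_mul, conjTranspose_conjTranspose, Matrix.mul_assoc]

lemma signature_eq {k : ℕ} {A B : Matrix (Fin k) (Fin k) ℂ} (hA : A.IsHermitian)
    (hB : B.IsHermitian) (h : ∃ c, A = c * B * cᴴ) (h' : ∃ c, B = c * A * cᴴ) :
    signature hA = signature hB := by
  classical
  obtain ⟨c, hc⟩ := h
  obtain ⟨d, hd⟩ := h'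
  have hp := le_antisymm (inertia_le hA hB c hc 1) (inertia_le hB hA d hd 1)
  have hn := le_antisymm (inertia_le hA hB c hc (-1)) (inertia_le hB hA d hd (-1))
  simp only [one_mul, neg_one_mul, neg_pos] at hp hn
  have tot : ∀ {C : Matrix (Fin k) (Fin k) ℂ} (hC : C.IsHermitian),
      Nat.card {i // 0 < hC.eigenvalues i} + Nat.card {i // hC.eigenvalues i < 0} +
      Nat.card {i // hC.eigenvalues i = 0} = k := by
    intro C hC
    simp only [Nat.card_eq_fintype_card, Fintype.card_subtype, Finset.card_filter,
      ← Finset.sum_add_distrib]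
    conv_rhs => rw [← Fintype.card_fin k, ← Finset.card_univ, Finset.card_eq_sum_ones]
    refine Finset.sum_congr rfl fun i _ => ?_
    rcases lt_trichotomy (hC.eigenvalues i) 0 with h | h | h
    · simp [h, h.ne, h.le]
    · simp [h]
    · simp [h, h.ne', h.le]
  have a := tot hA
  have b := tot hB
  unfold signature
  ext <;> simp only <;> omega

lemma forward {m : ℕ} {z z' : Matrix (Fin m) (Fin m) ℂ}
    (hz : z.IsHermitian) (hz' : z'.IsHermitian) (h : BRel z z') :
      ((∀ (p q : ℕ) (hpq : p ≤ q) (hq : q < m),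
          (z.submatrix (tailEmb m p (le_trans hpq hq.le)) (tailEmb m q hq.le)).rank =
          (z'.submatrix (tailEmb m p (le_trans hpq hq.le)) (tailEmb m q hq.le)).rank) ∧
       (∀ (p : ℕ) (hp : p < m),
          signature (hz.submatrix (tailEmb m p hp.le)) =
          signature (hz'.submatrix (tailEmb m p hp.le)))) := by
  refine ⟨fun p q hpq hq => le_antisymm (h.symm.rank_le ..) (h.rank_le ..), fun p hp => ?_⟩
  apply signature_eq
  · obtain ⟨b, -, tb, rfl⟩ := h.symm
    exact ⟨_, tail_mul _ _ tb ..⟩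
  · obtain ⟨b, -, tb, rfl⟩ := h
    exact ⟨_, tail_mul _ _ tb ..⟩

lemma rank_one_step {m : ℕ} (w : Matrix (Fin m) (Fin m) ℂ) (u v : Fin m → ℂ)
    (h1 : ∀ a c, c < a → u a * v c = 0) (h2 : ∀ a, 1 + u a * v a ≠ 0) :
    ∃ w', BRel w w' ∧ ∀ a c, w' a c = w a c + u a * ∑ l, v l * w l c +
      (∑ l, w a l * star (v l)) * star (u c) +
      u a * star (u c) * ∑ l, v l * ∑ l', w l l' * star (v l') := by
  have tb : (1 + vecMulVec u v : Matrix (Fin m) (Fin m) ℂ).BlockTriangular id := by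
    intro i j hij
    simp only [id] at hij
    simp [vecMulVec_apply, h1 i j hij, hij.ne']
  refine ⟨_, ⟨1 + vecMulVec u v, ?_, tb, rfl⟩, ?_⟩
  · rw [Matrix.isUnit_iff_isUnit_det, det_of_isUpperTriangular tb, isUnit_iff_ne_zero,
      Finset.prod_ne_zero_iff]
    intro a _
    simpa [vecMulVec_apply] using h2 a
  · intro a c
    have e1 : ∀ a c, ((1 + vecMulVec u v) * w) a c = w a c + u a * ∑ l, v l * w l c := by
      intro a c
      rw [Matrix.add_mul, Matrix.one_mul, Matrix.add_apply, Matrix.mul_apply, Finset.mul_sum]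
      simp only [vecMulVec_apply, mul_assoc]
    have e2 : ∀ (x : Matrix (Fin m) (Fin m) ℂ) a c, (x * (1 + vecMulVec u v : Matrix (Fin m) (Fin m) ℂ)ᴴ) a c =
        x a c + (∑ l, x a l * star (v l)) * star (u c) := by
      intro x a c
      rw [conjTranspose_add, conjTranspose_one, Matrix.mul_add, Matrix.mul_one, Matrix.add_apply,
        Matrix.mul_apply, Finset.sum_mul]
      congr 1
      refine Finset.sum_congr rfl fun l _ => ?_
      simp only [vecMulVec_apply, conjTranspose_apply, star_mul']
      ring
    rw [e2, e1]
    simp only [e1]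
    have e3 : ∑ l, (w a l + u a * ∑ l', v l' * w l' l) * star (v l) =
        ∑ l, w a l * star (v l) + u a * ∑ l, v l * ∑ l', w l l' * star (v l') := by
      simp only [add_mul, Finset.sum_add_distrib, Finset.mul_sum, Finset.sum_mul]
      congr 1
      rw [Finset.sum_comm]
      refine Finset.sum_congr rfl fun l _ => Finset.sum_congr rfl fun l' _ => ?_
      ring
    rw [e3]
    ring

structure CanonFrom {m : ℕ} (k : ℕ) (w : Matrix (Fin m) (Fin m) ℂ) : Prop where
  herm : w.IsHermitian
  uniq : ∀ i j j' : Fin m, k ≤ i.1 → k ≤ j.1 → k ≤ j'.1 → w i j ≠ 0 → w i j' ≠ 0 → j = j'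
  val : ∀ i j : Fin m, k ≤ i.1 → k ≤ j.1 → w i j = 0 ∨ w i j = 1 ∨ (i = j ∧ w i j = -1)

lemma CanonFrom.symm {m k : ℕ} {w : Matrix (Fin m) (Fin m) ℂ} (h : CanonFrom k w)
    (i j : Fin m) (hi : k ≤ i.1) (hj : k ≤ j.1) : w j i = w i j := by
  rw [← h.herm.apply]
  rcases h.val i j hi hj with h | h | ⟨-, h⟩ <;> simp [h]

lemma CanonFrom.sq {m k : ℕ} {w : Matrix (Fin m) (Fin m) ℂ} (h : CanonFrom k w)
    (i j : Fin m) (hi : k ≤ i.1) (hj : k ≤ j.1) (h0 : w i j ≠ 0) : w i j * w i j = 1 := by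
  rcases h.val i j hi hj with h | h | ⟨-, h⟩
  · exact absurd h h0
  · simp [h]
  · simp [h]

lemma canon_extend {m : ℕ} (κ : Fin m) {w : Matrix (Fin m) (Fin m) ℂ} (h : CanonFrom (κ.1 + 1) w)
    (hu : ∀ j j' : Fin m, κ ≤ j → κ ≤ j' → w κ j ≠ 0 → w κ j' ≠ 0 → j = j')
    (hv : ∀ j : Fin m, κ ≤ j → w κ j = 0 ∨ w κ j = 1 ∨ (κ = j ∧ w κ j = -1))
    (hK : ∀ j, κ < j → w κ j ≠ 0 → ∀ i, κ < i → w i j = 0) : CanonFrom κ.1 w := by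
  have st : ∀ i j, w i j ≠ 0 → w j i ≠ 0 := by
    intro i j hij h0
    rw [← h.herm.apply, h0] at hij
    simp at hij
  refine ⟨h.herm, ?_, ?_⟩
  · intro i j j' hi hj hj' h1 h2
    rcases (show κ ≤ i from hi).eq_or_lt with rfl | hi
    · exact hu j j' hj hj' h1 h2
    rcases (show κ ≤ j from hj).eq_or_lt with rfl | hj <;>
    rcases (show κ ≤ j' from hj').eq_or_lt with rfl | hj'
    · rfl
    · exact absurd (hK i hi (st _ _ h1) j' hj') (st _ _ h2)
    · exact absurd (hK i hi (st _ _ h2) j hj) (st _ _ h1)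
    · exact h.uniq i j j' hi hj hj' h1 h2
  · intro i j hi hj
    rcases (show κ ≤ i from hi).eq_or_lt with rfl | hi
    · exact hv j hj
    rcases (show κ ≤ j from hj).eq_or_lt with rfl | hj
    · rw [← h.herm.apply]
      rcases hv i hi.le with h | h | ⟨h, -⟩
      · simp [h]
      · simp [h]
      · exact absurd h hi.ne
    · exact h.val i j hi hj

lemma canon_congr {m : ℕ} (κ : Fin m) {w w' : Matrix (Fin m) (Fin m) ℂ}
    (h : CanonFrom (κ.1 + 1) w) (hw' : w'.IsHermitian)
    (he : ∀ i j, κ < i → κ < j → w' i j = w i j) : CanonFrom (κ.1 + 1) w' := by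
  refine ⟨hw', ?_, ?_⟩
  · intro i j j' hi hj hj'
    rw [he i j hi hj, he i j' hi hj']
    exact h.uniq i j j' hi hj hj'
  · intro i j hi hj
    rw [he i j hi hj]
    exact h.val i j hi hj

lemma canon_step1 {m : ℕ} (κ : Fin m) (w : Matrix (Fin m) (Fin m) ℂ)
    (h : CanonFrom (κ.1 + 1) w) : ∃ w', BRel w w' ∧ CanonFrom (κ.1 + 1) w' ∧
      (∀ j, κ < j → w' κ j ≠ 0 → ∀ i, κ < i → w' i j = 0) := by
  let v : Fin m → ℂ := fun i => if κ < i then - ∑ l, if κ < l then w κ l * w l i else 0 else 0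
  obtain ⟨w', hr, hw'⟩ := rank_one_step w (Pi.single κ 1) v
    (by
      intro a c hca
      by_cases ha : a = κ
      · subst ha; simp [v, not_lt.2 hca.le]
      · simp [ha])
    (by
      intro a
      by_cases ha : a = κ
      · subst ha; simp [v]
      · simp [ha])
  have he : ∀ i j, κ < i → κ < j → w' i j = w i j := by
    intro i j hi hj
    rw [hw']; simp [hi.ne', hj.ne']
  refine ⟨w', hr, canon_congr κ h (hr.herm h.herm) he, ?_⟩
  intro j hj hne i hi
  rw [he i j hi hj]
  by_contra h0
  apply hne
  rw [hw']
  simp only [Pi.single_eq_same, one_mul, Pi.single_eq_of_ne hj.ne', star_zero, mul_zero, zero_mul,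
    add_zero]
  have hji : w j i ≠ 0 := by rw [h.symm i j hi hj]; exact h0
  rw [Finset.sum_eq_single i]
  · have : v i = - (w κ j * w j i) := by
      simp only [v, hi, if_true]
      rw [Finset.sum_eq_single j]
      · simp [hj]
      · intro l _ hl
        split_ifs with hκ
        · by_cases hli : w l i = 0
          · simp [hli]
          · refine absurd (h.uniq i l j hi hκ hj ?_ h0) hl
            rw [h.symm l i hκ hi]; exact hli
        · rfl
      · simp
    rw [this, h.symm i j hi hj]
    linear_combination (- w κ j) * h.sq i j hi hj h0
  · intro l _ hl
    by_cases hκ : κ < l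
    · by_cases hlj : w l j = 0
      · simp [hlj]
      · refine absurd (h.uniq j l i hj hκ hi ?_ hji) hl
        rw [h.symm l j hκ hj]; exact hlj
    · simp [v, hκ]
  · simp

lemma canon_step2 {m : ℕ} (κ : Fin m) (w : Matrix (Fin m) (Fin m) ℂ)
    (h : CanonFrom (κ.1 + 1) w)
    (hK : ∀ j, κ < j → w κ j ≠ 0 → ∀ i, κ < i → w i j = 0) :
    ∃ w', BRel w w' ∧ CanonFrom κ.1 w' := by
  classical
  have hst : ∀ i j, star (w i j) = w j i := fun i j => h.herm.apply j i
  by_cases hex : ∃ j, κ < j ∧ w κ j ≠ 0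
  · obtain ⟨j, ⟨hj, hj0⟩, hmax⟩ : ∃ j, (κ < j ∧ w κ j ≠ 0) ∧ ∀ l, j < l → w κ l = 0 := by
      obtain ⟨j0, hj0⟩ := hex
      obtain ⟨j, hj, hm⟩ := Finset.exists_max_image
        (Finset.univ.filter fun j => κ < j ∧ w κ j ≠ 0) id ⟨j0, by simpa using hj0⟩
      simp only [Finset.mem_filter, Finset.mem_univ, true_and, id] at hj hm
      refine ⟨j, hj, fun l hl => ?_⟩
      by_contra h0
      exact absurd (hm l ⟨hj.1.trans hl, h0⟩) (not_le.2 hl)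
    have hjκ : w j κ ≠ 0 := by
      rw [← hst]; simpa using hj0
    have hwj : ∀ i, κ < i → w i j = 0 := hK j hj hj0
    have hwj' : ∀ i, κ < i → w j i = 0 := fun i hi => by rw [← hst, hwj i hi, star_zero]
    let u : Fin m → ℂ := fun i =>
      if i < κ then 0 else if i = κ then - w κ κ / (2 * w j κ)
      else if i = j then (w j κ)⁻¹ - 1 else - (w i κ / w j κ)
    have hu0 : ∀ i, j < i → u i = 0 := by
      intro i hi
      have : w i κ = 0 := by rw [← hst, hmax i hi, star_zero]
      have h1 := hj.trans hi
      simp [u, not_lt.2 h1.le, h1.ne', hi.ne', this]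
    have huκ : u κ = - w κ κ / (2 * w j κ) := by simp [u]
    have huj : u j = (w j κ)⁻¹ - 1 := by simp [u, not_lt.2 hj.le, hj.ne']
    obtain ⟨w', hr, hw'⟩ := rank_one_step w u (Pi.single j 1)
      (by
        intro a c hca
        by_cases hc : c = j
        · subst hc; simp [hu0 a hca]
        · simp [hc])
      (by
        intro a
        by_cases ha : a = j
        · subst ha; simp [huj, hjκ]
        · simp [ha])
    have hs : ∀ a c, w' a c = w a c + u a * w j c + w a j * star (u c) +
        u a * star (u c) * w j j := by
      intro a c
      rw [hw']
      simp [Pi.single_apply]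
    have he : ∀ i l, κ < i → κ < l → w' i l = w i l := by
      intro i l hi hl
      rw [hs, hwj i hi, hwj' l hl, hwj j hj]; ring
    have hκc : ∀ c, κ < c → w' κ c = if c = j then 1 else 0 := by
      intro c hc
      rw [hs, hwj' c hc, hwj j hj]
      split_ifs with hcj
      · subst hcj
        rw [huj, star_sub, star_inv₀, hst, star_one]
        field_simp
        ring
      · have : u c = - (w c κ / w j κ) := by simp [u, not_lt.2 hc.le, hc.ne', hcj]
        rw [this, star_neg, star_div₀, hst, hst]
        field_simp
        ring
    have hκκ : w' κ κ = 0 := by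
      rw [hs, hwj j hj, huκ, star_div₀, star_neg, star_mul', hst, hst]
      have : star (2 : ℂ) = 2 := by simp
      rw [this]
      field_simp
      ring
    have hwκ : ∀ c, κ ≤ c → w' κ c = if c = j then 1 else 0 := by
      intro c hc
      rcases hc.eq_or_lt with rfl | hc
      · rw [hκκ, if_neg hj.ne]
      · exact hκc c hc
    refine ⟨w', hr, canon_extend κ (canon_congr κ h (hr.herm h.herm) he) ?_ ?_ ?_⟩
    · intro a c ha hc h1 h2
      rw [hwκ a ha] at h1
      rw [hwκ c hc] at h2
      simp at h1 h2
      rw [h1, h2]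
    · intro a ha
      rw [hwκ a ha]
      split_ifs <;> simp
    · intro a ha h1 i hi
      rw [hκc a ha] at h1
      simp at h1
      subst h1
      rw [he i a hi ha, hwj i hi]
  · push Not at hex
    obtain ⟨r, hrr⟩ : ∃ r : ℝ, w κ κ = r := ⟨(w κ κ).re, by
      have := hst κ κ
      exact (Complex.conj_eq_iff_re.1 this).symm⟩
    obtain ⟨s, hs0, hs⟩ : ∃ s : ℝ, s ≠ 0 ∧ (s * s * r = 0 ∨ s * s * r = 1 ∨ s * s * r = -1) := by
      rcases lt_trichotomy r 0 with h | h | h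
      · refine ⟨(Real.sqrt (-r))⁻¹, ?_, Or.inr (Or.inr ?_)⟩
        · have : 0 < Real.sqrt (-r) := Real.sqrt_pos.2 (by linarith)
          positivity
        · rw [← mul_inv, Real.mul_self_sqrt (by linarith), inv_neg, neg_mul, inv_mul_cancel₀ h.ne]
      · exact ⟨1, one_ne_zero, Or.inl (by simp [h])⟩
      · refine ⟨(Real.sqrt r)⁻¹, ?_, Or.inr (Or.inl ?_)⟩
        · have : 0 < Real.sqrt r := Real.sqrt_pos.2 h
          positivity
        · rw [← mul_inv, Real.mul_self_sqrt h.le]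
          field_simp
    obtain ⟨w', hr, hw'⟩ := rank_one_step w (Pi.single κ ((s : ℂ) - 1)) (Pi.single κ 1)
      (by
        intro a c hca
        by_cases hc : c = κ
        · subst hc; simp [hca.ne']
        · simp [hc])
      (by
        intro a
        by_cases ha : a = κ
        · subst ha; simp [hs0]
        · simp [ha])
    have he : ∀ i j, κ < i → κ < j → w' i j = w i j := by
      intro i j hi hj
      rw [hw']; simp [hi.ne', hj.ne']
    have h0 : ∀ c, κ < c → w' κ c = 0 := by
      intro c hc
      rw [hw']; simp [hc.ne', hex c hc, Pi.single_apply]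
    have hκκ : w' κ κ = ((s * s * r : ℝ) : ℂ) := by
      rw [hw']
      simp [Pi.single_apply, hrr]
      ring
    have h0' : ∀ c, κ ≤ c → w' κ c ≠ 0 → c = κ := by
      intro c hc h1
      rcases hc.eq_or_lt with rfl | hc
      · rfl
      · exact absurd (h0 c hc) h1
    refine ⟨w', hr, canon_extend κ (canon_congr κ h (hr.herm h.herm) he) ?_ ?_ ?_⟩
    · intro a c ha hc h1 h2
      rw [h0' a ha h1, h0' c hc h2]
    · intro a ha
      rcases ha.eq_or_lt with rfl | ha
      · rw [hκκ]
        rcases hs with h | h | h <;> rw [h] <;> simp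
      · exact Or.inl (h0 a ha)
    · intro a ha h1
      exact absurd (h0 a ha) h1

lemma exists_canon {m : ℕ} (z : Matrix (Fin m) (Fin m) ℂ) (hz : z.IsHermitian) :
    ∃ w, BRel z w ∧ CanonFrom 0 w := by
  have : ∀ d k, k + d = m → ∃ w, BRel z w ∧ CanonFrom k w := by
    intro d
    induction d with
    | zero =>
      intro k hk
      exact ⟨z, BRel.refl z, hz, fun i _ _ hi => by omega, fun i _ hi => by omega⟩
    | succ d ih =>
      intro k hk
      obtain ⟨w, h1, h2⟩ := ih (k + 1) (by omega)
      obtain ⟨w1, h3, h4, h5⟩ := canon_step1 ⟨k, by omega⟩ w h2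
      obtain ⟨w2, h6, h7⟩ := canon_step2 ⟨k, by omega⟩ w1 h4 h5
      exact ⟨w2, (h1.trans h3).trans h6, h7⟩
  exact this m 0 (by omega)

open scoped ComplexOrder in
lemma rank_monomial {a b : ℕ} (M : Matrix (Fin a) (Fin b) ℂ)
    (h : ∀ i i' j, M i j ≠ 0 → M i' j ≠ 0 → i = i') :
    M.rank = Nat.card {i // ∃ j, M i j ≠ 0} := by
  classical
  have hd : M * Mᴴ = diagonal (fun i => ((∑ j, Complex.normSq (M i j) : ℝ) : ℂ)) := by
    ext i i'
    rw [Matrix.mul_apply, diagonal_apply]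
    split_ifs with hii
    · subst hii
      push_cast
      refine Finset.sum_congr rfl fun j _ => ?_
      rw [Complex.normSq_eq_conj_mul_self, conjTranspose_apply, mul_comm]; rfl
    · refine Finset.sum_eq_zero fun j _ => ?_
      by_cases h1 : M i j = 0
      · simp [h1]
      · by_cases h2 : M i' j = 0
        · simp [h2]
        · exact absurd (h i i' j h1 h2) hii
  rw [← rank_self_mul_conjTranspose, hd, rank_diagonal, Nat.card_eq_fintype_card]
  refine Fintype.card_congr (Equiv.subtypeEquivRight fun i => ?_)
  rw [Ne, Complex.ofReal_eq_zero,
    Finset.sum_eq_zero_iff_of_nonneg (fun j _ => Complex.normSq_nonneg _)]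
  simp

lemma canon_rank {m : ℕ} {w : Matrix (Fin m) (Fin m) ℂ} (h : CanonFrom 0 w) (p q : ℕ)
    (hp : p ≤ m) (hq : q ≤ m) [DecidablePred fun i : Fin m => ∃ j : Fin m, q ≤ j.1 ∧ w i j ≠ 0] :
    (w.submatrix (tailEmb m p hp) (tailEmb m q hq)).rank =
      ∑ i : Fin m, if p ≤ i.1 then (if ∃ j : Fin m, q ≤ j.1 ∧ w i j ≠ 0 then 1 else 0) else 0 := by
  classical
  rw [rank_monomial]
  · rw [← tailEmb_sum m p hp (fun i => if ∃ j : Fin m, q ≤ j.1 ∧ w i j ≠ 0 then 1 else 0),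
      Nat.card_eq_fintype_card, Fintype.card_subtype, Finset.card_filter]
    refine Finset.sum_congr rfl fun i _ => ?_
    refine if_congr ?_ rfl rfl
    constructor
    · rintro ⟨j, hj⟩
      exact ⟨tailEmb m q hq j, by simp [tailEmb], hj⟩
    · rintro ⟨j, hj, hw⟩
      refine ⟨⟨j.1 - q, by omega⟩, ?_⟩
      have : tailEmb m q hq ⟨j.1 - q, by omega⟩ = j := by
        simp [tailEmb, Fin.ext_iff]; omega
      rw [Matrix.submatrix_apply, this]; exact hw
  · intro i i' j h1 h2
    simp only [Matrix.submatrix_apply] at h1 h2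
    rw [h.symm _ _ (Nat.zero_le _) (Nat.zero_le _)] at h1 h2
    have := h.uniq _ _ _ (Nat.zero_le _) (Nat.zero_le _) (Nat.zero_le _) h1 h2
    simpa [tailEmb, Fin.ext_iff] using this

lemma canon_trace {k : ℕ} {A : Matrix (Fin k) (Fin k) ℂ} (h : CanonFrom 0 A)
    (hA : A.IsHermitian) :
    A.trace = ((signature hA).1 : ℂ) - ((signature hA).2.1 : ℂ) := by
  classical
  have hcube : A * (A * A) = A := by
    ext i j
    have z : ∀ n : Fin k, 0 ≤ n.1 := fun n => Nat.zero_le _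
    rw [Matrix.mul_apply]
    by_cases hij : ∃ l, A i l ≠ 0
    · obtain ⟨l, hl⟩ := hij
      rw [Finset.sum_eq_single l, Matrix.mul_apply, Finset.sum_eq_single i]
      · rw [h.symm i l (z _) (z _), ← mul_assoc, h.sq i l (z _) (z _) hl, one_mul]
      · intro n _ hn
        by_cases h0 : A l n = 0
        · simp [h0]
        · refine absurd (h.uniq l n i (z _) (z _) (z _) h0 ?_) hn
          rw [h.symm i l (z _) (z _)]; exact hl
      · simp
      · intro n _ hn
        by_cases h0 : A i n = 0
        · simp [h0]
        · exact absurd (h.uniq i n l (z _) (z _) (z _) h0 hl) hn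
      · simp
    · push Not at hij
      simp [hij]
  have hev : ∀ i, hA.eigenvalues i = 0 ∨ hA.eigenvalues i = 1 ∨ hA.eigenvalues i = -1 := by
    intro i
    have h1 := hA.mulVec_eigenvectorBasis i
    set v : Fin k → ℂ := ⇑(hA.eigenvectorBasis i) with hv
    have hv0 : v ≠ 0 := by
      intro h0
      apply hA.eigenvectorBasis.toBasis.ne_zero i
      ext j
      have := congrFun h0 j
      simpa [hv] using this
    set t := hA.eigenvalues i
    have h3 : (t * (t * t)) • v = t • v := by
      have : A *ᵥ (A *ᵥ (A *ᵥ v)) = A *ᵥ v := by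
        rw [mulVec_mulVec, mulVec_mulVec, Matrix.mul_assoc, hcube]
      rw [h1, mulVec_smul, h1, mulVec_smul, mulVec_smul, h1, smul_smul, smul_smul] at this
      rw [← mul_assoc]; exact this
    have h4 : t * (t * t) = t := smul_left_injective ℝ hv0 h3
    have h5 : t * ((t - 1) * (t + 1)) = 0 := by linear_combination h4
    rcases mul_eq_zero.1 h5 with h | h
    · exact Or.inl h
    · rcases mul_eq_zero.1 h with h | h
      · exact Or.inr (Or.inl (by linarith))
      · exact Or.inr (Or.inr (by linarith))
  rw [hA.trace_eq_sum_eigenvalues]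
  simp only [signature, Nat.card_eq_fintype_card, Fintype.card_subtype, Finset.card_filter]
  push_cast
  rw [← Finset.sum_sub_distrib]
  refine Finset.sum_congr rfl fun i _ => ?_
  rcases hev i with h | h | h <;> rw [h] <;> norm_num

lemma canon_tail {m : ℕ} {w : Matrix (Fin m) (Fin m) ℂ} (h : CanonFrom 0 w) (p : ℕ) (hp : p ≤ m) :
    CanonFrom 0 (w.submatrix (tailEmb m p hp) (tailEmb m p hp)) := by
  have inj : ∀ i j, tailEmb m p hp i = tailEmb m p hp j → i = j := by
    intro i j hij; simpa [tailEmb, Fin.ext_iff] using hij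
  refine ⟨h.herm.submatrix _, ?_, ?_⟩
  · intro i j j' _ _ _ h1 h2
    exact inj _ _ (h.uniq _ _ _ (Nat.zero_le _) (Nat.zero_le _) (Nat.zero_le _) h1 h2)
  · intro i j _ _
    rcases h.val (tailEmb m p hp i) (tailEmb m p hp j) (Nat.zero_le _) (Nat.zero_le _) with
      h | h | ⟨h', h⟩
    · exact Or.inl h
    · exact Or.inr (Or.inl h)
    · exact Or.inr (Or.inr ⟨inj _ _ h', h⟩)

lemma sum_tail_succ {M : Type*} [AddCommMonoid M] {m : ℕ} (i : Fin m) (f : Fin m → M) :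
    (∑ j : Fin m, if i.1 ≤ j.1 then f j else 0) =
      f i + ∑ j : Fin m, if i.1 + 1 ≤ j.1 then f j else 0 := by
  classical
  have : f i = ∑ j, if j = i then f j else 0 := by simp
  rw [this, ← Finset.sum_add_distrib]
  refine Finset.sum_congr rfl fun j _ => ?_
  rcases lt_trichotomy i j with h | h | h
  · have h' : i.1 < j.1 := h
    simp [h.ne', h'.le, Nat.succ_le_of_lt h']
  · subst h; simp
  · have h' : j.1 < i.1 := h
    simp [h.ne, not_le.2 h', not_le.2 (h'.trans (Nat.lt_succ_self _))]

open scoped ComplexOrder in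
lemma canon_unique {m : ℕ} {z z' : Matrix (Fin m) (Fin m) ℂ} (h : CanonFrom 0 z)
    (h' : CanonFrom 0 z') (hz : z.IsHermitian) (hz' : z'.IsHermitian)
    (H1 : ∀ (p q : ℕ) (hpq : p ≤ q) (hq : q < m),
          (z.submatrix (tailEmb m p (le_trans hpq hq.le)) (tailEmb m q hq.le)).rank =
          (z'.submatrix (tailEmb m p (le_trans hpq hq.le)) (tailEmb m q hq.le)).rank)
    (H2 : ∀ (p : ℕ) (hp : p < m),
          signature (hz.submatrix (tailEmb m p hp.le)) =
          signature (hz'.submatrix (tailEmb m p hp.le))) : z = z' := by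
  classical
  have R1 : ∀ (p q : ℕ) (hpq : p ≤ q) (hq : q ≤ m),
      (z.submatrix (tailEmb m p (hpq.trans hq)) (tailEmb m q hq)).rank =
      (z'.submatrix (tailEmb m p (hpq.trans hq)) (tailEmb m q hq)).rank := by
    intro p q hpq hq
    rcases hq.eq_or_lt with rfl | hq'
    · have e : ∀ x : Matrix (Fin q) (Fin q) ℂ,
          (x.submatrix (tailEmb q p (hpq.trans hq)) (tailEmb q q hq)).rank = 0 := by
        intro x
        have := Matrix.rank_le_width (x.submatrix (tailEmb q p (hpq.trans hq)) (tailEmb q q hq))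
        omega
      rw [e, e]
    · exact H1 p q hpq hq'
  have R2 : ∀ (p q : ℕ) (hp : p ≤ m) (hq : q ≤ m),
      (z.submatrix (tailEmb m p hp) (tailEmb m q hq)).rank =
      (z'.submatrix (tailEmb m p hp) (tailEmb m q hq)).rank := by
    intro p q hp hq
    rcases le_total p q with hpq | hpq
    · exact R1 p q hpq hq
    · rw [← rank_conjTranspose, conjTranspose_submatrix, hz.eq,
        ← rank_conjTranspose (z'.submatrix _ _), conjTranspose_submatrix, hz'.eq]
      exact R1 q p hpq hp
  have S : ∀ (i : Fin m) (q : ℕ), q ≤ m →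
      ((∃ j : Fin m, q ≤ j.1 ∧ z i j ≠ 0) ↔ (∃ j : Fin m, q ≤ j.1 ∧ z' i j ≠ 0)) := by
    intro i q hq
    have a := R2 i.1 q i.2.le hq
    have b := R2 (i.1 + 1) q i.2 hq
    rw [canon_rank h, canon_rank h'] at a b
    rw [sum_tail_succ, sum_tail_succ, b] at a
    have := Nat.add_right_cancel a
    by_cases h1 : ∃ j : Fin m, q ≤ j.1 ∧ z i j ≠ 0 <;>
    by_cases h2 : ∃ j : Fin m, q ≤ j.1 ∧ z' i j ≠ 0
    · exact iff_of_true h1 h2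
    · rw [if_pos h1, if_neg h2] at this; exact absurd this one_ne_zero
    · rw [if_neg h1, if_pos h2] at this; exact absurd this zero_ne_one
    · exact iff_of_false h1 h2
  have D : ∀ i, z i i = z' i i := by
    have T : ∀ p (hp : p ≤ m), (z.submatrix (tailEmb m p hp) (tailEmb m p hp)).trace =
        (z'.submatrix (tailEmb m p hp) (tailEmb m p hp)).trace := by
      intro p hp
      rcases hp.eq_or_lt with rfl | hp'
      · have : IsEmpty (Fin (p - p)) := by rw [Nat.sub_self]; infer_instance
        simp [Matrix.trace]
      · rw [canon_trace (canon_tail h p hp) (hz.submatrix _),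
          canon_trace (canon_tail h' p hp) (hz'.submatrix _), H2 p hp']
    have T' : ∀ p (hp : p ≤ m), (∑ j : Fin m, if p ≤ j.1 then z j j else 0) =
        ∑ j : Fin m, if p ≤ j.1 then z' j j else 0 := by
      intro p hp
      rw [← tailEmb_sum m p hp (fun j => z j j), ← tailEmb_sum m p hp (fun j => z' j j)]
      exact T p hp
    intro i
    have a := T' i.1 i.2.le
    rw [sum_tail_succ i (fun j => z j j), sum_tail_succ i (fun j => z' j j), T' (i.1 + 1) i.2] at a
    exact add_right_cancel a
  have imp : ∀ {x y : Matrix (Fin m) (Fin m) ℂ}, CanonFrom 0 x → CanonFrom 0 y →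
      (∀ (i : Fin m) (q : ℕ), q ≤ m →
      ((∃ j : Fin m, q ≤ j.1 ∧ x i j ≠ 0) ↔ (∃ j : Fin m, q ≤ j.1 ∧ y i j ≠ 0))) →
      ∀ i j, x i j ≠ 0 → y i j ≠ 0 := by
    intro x y hx hy hS i j hij
    obtain ⟨l, hl, hyl⟩ := (hS i j.1 j.2.le).1 ⟨j, le_rfl, hij⟩
    obtain ⟨n, hn, hxn⟩ := (hS i l.1 l.2.le).2 ⟨l, le_rfl, hyl⟩
    have := hx.uniq i n j (Nat.zero_le _) (Nat.zero_le _) (Nat.zero_le _) hxn hij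
    subst this
    have : l = n := Fin.ext (le_antisymm hn hl)
    rw [← this]; exact hyl
  ext i j
  by_cases hij : i = j
  · subst hij; exact D i
  · have a := imp h h' S i j
    have b := imp h' h (fun i q hq => (S i q hq).symm) i j
    rcases h.val i j (Nat.zero_le _) (Nat.zero_le _) with h1 | h1 | ⟨h1, -⟩
    · by_contra hne
      rw [h1] at hne
      exact b (Ne.symm hne) h1
    · rcases h'.val i j (Nat.zero_le _) (Nat.zero_le _) with h2 | h2 | ⟨h2, -⟩
      · exact absurd h2 (a (by simp [h1]))
      · rw [h1, h2]
      · exact absurd h2 hij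
    · exact absurd h1 hij

/-- `z, z' ∈ Her_m(ℂ)` lie in the same `B_m(ℂ)`-orbit (for `b · z = b z b*`) iff all
the ranks `rank z_{[p]ᶜ[q]ᶜ}` (for `0 ≤ p ≤ q < m`) and the signatures
`sign z_{[p]ᶜ}` (for `0 ≤ p < m`) agree. -/
theorem stmt4 {m : ℕ} (z z' : Matrix (Fin m) (Fin m) ℂ)
    (hz : z.IsHermitian) (hz' : z'.IsHermitian) :
    (∃ b : Matrix (Fin m) (Fin m) ℂ, IsUnit b ∧ b.BlockTriangular id ∧
        b * z * bᴴ = z') ↔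
      ((∀ (p q : ℕ) (hpq : p ≤ q) (hq : q < m),
          (z.submatrix (tailEmb m p (le_trans hpq hq.le)) (tailEmb m q hq.le)).rank =
          (z'.submatrix (tailEmb m p (le_trans hpq hq.le)) (tailEmb m q hq.le)).rank) ∧
       (∀ (p : ℕ) (hp : p < m),
          signature (hz.submatrix (tailEmb m p hp.le)) =
          signature (hz'.submatrix (tailEmb m p hp.le)))) := by
  constructor
  · intro h
    exact forward hz hz' h
  · rintro ⟨H1, H2⟩
    obtain ⟨w, hw, cw⟩ := exists_canon z hz
    obtain ⟨w', hw', cw'⟩ := exists_canon z' hz'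
    obtain ⟨F1, F2⟩ := forward hz cw.herm hw
    obtain ⟨G1, G2⟩ := forward hz' cw'.herm hw'
    have e : w = w' := canon_unique cw cw' cw.herm cw'.herm
      (fun p q hpq hq => by rw [← F1 p q hpq hq, H1 p q hpq hq, G1 p q hpq hq])
      (fun p hp => by rw [← F2 p hp, H2 p hp, G2 p hp])
    subst e
    exact hw.trans hw'.symm
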